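/- Let E be a weak Fraïssé real Banach space. Then the four functions γ_E^a, γ_E, D_E^a, D_E coincide on pairs of finite-dimensional subspaces of E: for all finite-dimensional subspaces X, Y of E, γ_E^a(X,Y) = γ_E(X,Y) = D_E^a(X,Y) = D_E(X,Y). -/

import Mathlib

noncomputable section

/-- `φ` is a `δ`-isometry (a member of `Emb_δ(X,E)`). -/
def IsEmb {E X : Type*} [NormedAddCommGroup E] [NormedSpace ℝ E]
    [NormedAddCommGroup X] [NormedSpace ℝ X] (δ : ℝ) (φ : X →L[ℝ] E) : Prop :=
  ∀ x : X, (1 + δ)⁻¹ * ‖x‖ ≤ ‖φ x‖ ∧ ‖φ x‖ ≤ (1 + δ) * ‖x‖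

/-- `T` is a surjective `ε`-isometry of `E`. -/
def IsEpsIsom {E : Type*} [NormedAddCommGroup E] [NormedSpace ℝ E]
    (ε : ℝ) (T : E ≃L[ℝ] E) : Prop :=
  ∀ z : E, (1 + ε)⁻¹ * ‖z‖ ≤ ‖T z‖ ∧ ‖T z‖ ≤ (1 + ε) * ‖z‖

/-- The closed unit ball of a subspace `X` of `E`, viewed as a subset of `E`. -/
def ballSet {E : Type*} [NormedAddCommGroup E] [NormedSpace ℝ E]
    (X : Subspace ℝ E) : Set E :=
  {x : E | x ∈ X ∧ ‖x‖ ≤ 1}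

/-- `d_δ(X,Y) = inf { d_H(t(B_X), s(B_Y)) : t ∈ Emb_δ(X,E), s ∈ Emb_δ(Y,E) }`. -/
def dDelta {E : Type*} [NormedAddCommGroup E] [NormedSpace ℝ E]
    (δ : ℝ) (X Y : Subspace ℝ E) : ℝ :=
  sInf {r : ℝ | ∃ (t : X →L[ℝ] E) (s : Y →L[ℝ] E), IsEmb δ t ∧ IsEmb δ s ∧
    r = Metric.hausdorffDist ((fun x => t x) '' Metric.closedBall (0 : X) 1)
      ((fun y => s y) '' Metric.closedBall (0 : Y) 1)}

/-- `γ_E^a(X,Y) = sup_{δ > 0} d_δ(X,Y)`. -/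
def gammaA {E : Type*} [NormedAddCommGroup E] [NormedSpace ℝ E]
    (X Y : Subspace ℝ E) : ℝ :=
  ⨆ δ : Set.Ioi (0 : ℝ), dDelta (δ : ℝ) X Y

/-- `γ_E(X,Y) = inf { d_H(t(B_X), s(B_Y)) : t ∈ Emb_0(X,E), s ∈ Emb_0(Y,E) }`. -/
def gammaE {E : Type*} [NormedAddCommGroup E] [NormedSpace ℝ E]
    (X Y : Subspace ℝ E) : ℝ :=
  dDelta 0 X Y

/-- `D_δ(X,Y) = inf { d_H(T(B_X), U(B_Y)) : T, U ∈ Isom_δ(E) }`. -/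
def DDelta {E : Type*} [NormedAddCommGroup E] [NormedSpace ℝ E]
    (δ : ℝ) (X Y : Subspace ℝ E) : ℝ :=
  sInf {r : ℝ | ∃ T U : E ≃L[ℝ] E, IsEpsIsom δ T ∧ IsEpsIsom δ U ∧
    r = Metric.hausdorffDist ((fun z => T z) '' ballSet X) ((fun z => U z) '' ballSet Y)}

/-- `D_E^a(X,Y) = sup_{δ > 0} D_δ(X,Y)`. -/
def DistDA {E : Type*} [NormedAddCommGroup E] [NormedSpace ℝ E]
    (X Y : Subspace ℝ E) : ℝ :=
  ⨆ δ : Set.Ioi (0 : ℝ), DDelta (δ : ℝ) X Y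

/-- `D_E(X,Y) = inf { d_H(T(B_X), B_Y) : T ∈ Isom(E) }`. -/
def DistDE {E : Type*} [NormedAddCommGroup E] [NormedSpace ℝ E]
    (X Y : Subspace ℝ E) : ℝ :=
  sInf {r : ℝ | ∃ T : E ≃ₗᵢ[ℝ] E,
    r = Metric.hausdorffDist ((fun z => T z) '' ballSet X) (ballSet Y)}

/-- `E` is weak Fraïssé. -/
def WeakFraisse (E : Type*) [NormedAddCommGroup E] [NormedSpace ℝ E] : Prop :=
  ∀ (X : Subspace ℝ E), FiniteDimensional ℝ X → ∀ ε > (0 : ℝ), ∃ δ > (0 : ℝ),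
    ∀ φ ψ : X →L[ℝ] E, IsEmb δ φ → IsEmb δ ψ →
      ∃ T : E ≃ₗᵢ[ℝ] E, ‖T.toLinearIsometry.toContinuousLinearMap.comp φ - ψ‖ < ε

section Helpers

variable {E X Y : Type*} [NormedAddCommGroup E] [NormedSpace ℝ E]
  [NormedAddCommGroup X] [NormedSpace ℝ X] [NormedAddCommGroup Y] [NormedSpace ℝ Y]

theorem IsEmb.mono {δ δ' : ℝ} (h0 : 0 ≤ δ) (h : δ ≤ δ') {φ : X →L[ℝ] E} (hφ : IsEmb δ φ) :
    IsEmb δ' φ := fun x =>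
  ⟨(by gcongr : (1 + δ')⁻¹ * ‖x‖ ≤ (1 + δ)⁻¹ * ‖x‖).trans (hφ x).1,
    (hφ x).2.trans (by gcongr)⟩

theorem isEmb_subtypeL (X : Subspace ℝ E) : IsEmb 0 X.subtypeL := fun x => by simp

theorem IsEpsIsom.isEmb_comp_subtypeL {δ : ℝ} {T : E ≃L[ℝ] E} (hT : IsEpsIsom δ T)
    (X : Subspace ℝ E) : IsEmb δ ((T : E →L[ℝ] E).comp X.subtypeL) := fun x => hT x

theorem isEpsIsom_of_linearIsometryEquiv {δ : ℝ} (hδ : 0 ≤ δ) (T : E ≃ₗᵢ[ℝ] E) :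
    IsEpsIsom δ T.toContinuousLinearEquiv := fun z => by
  have h : ‖T.toContinuousLinearEquiv z‖ = ‖z‖ := T.norm_map z
  rw [h]
  exact ⟨mul_le_of_le_one_left (norm_nonneg z) (inv_le_one_of_one_le₀ (by linarith)),
    le_mul_of_one_le_left (norm_nonneg z) (by linarith)⟩

theorem image_ballSet (X : Subspace ℝ E) (f : E → E) :
    f '' ballSet X = (fun x : X => f x) '' Metric.closedBall (0 : X) 1 := by
  ext z
  simp [ballSet, and_assoc, and_left_comm]

theorem hausdorffEDist_image_closedBall_ne_top (f : X →L[ℝ] E) (g : Y →L[ℝ] E) :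
    Metric.hausdorffEDist ((fun x => f x) '' Metric.closedBall (0 : X) 1)
      ((fun y => g y) '' Metric.closedBall (0 : Y) 1) ≠ ⊤ :=
  Metric.hausdorffEDist_ne_top_of_nonempty_of_bounded
    ((Metric.nonempty_closedBall.2 zero_le_one).image _)
    ((Metric.nonempty_closedBall.2 zero_le_one).image _)
    (f.lipschitz.isBounded_image Metric.isBounded_closedBall)
    (g.lipschitz.isBounded_image Metric.isBounded_closedBall)

theorem hausdorffDist_image_closedBall_le (f g : X →L[ℝ] E) :
    Metric.hausdorffDist ((fun x => f x) '' Metric.closedBall (0 : X) 1)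
      ((fun x => g x) '' Metric.closedBall (0 : X) 1) ≤ ‖f - g‖ := by
  have key : ∀ x ∈ Metric.closedBall (0 : X) 1, dist (f x) (g x) ≤ ‖f - g‖ := fun x hx => by
    rw [dist_eq_norm]
    exact (f - g).unit_le_opNorm x (mem_closedBall_zero_iff.1 hx)
  refine Metric.hausdorffDist_le_of_mem_dist (norm_nonneg _) ?_ ?_
  · rintro _ ⟨x, hx, rfl⟩
    exact ⟨g x, ⟨x, hx, rfl⟩, key x hx⟩
  · rintro _ ⟨x, hx, rfl⟩
    exact ⟨f x, ⟨x, hx, rfl⟩, by rw [dist_comm]; exact key x hx⟩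

theorem hausdorffDist_image_closedBall_triangle (f f' : X →L[ℝ] E) (g g' : Y →L[ℝ] E) :
    Metric.hausdorffDist ((fun x => f x) '' Metric.closedBall (0 : X) 1)
        ((fun y => g y) '' Metric.closedBall (0 : Y) 1) ≤
      ‖f - f'‖ + Metric.hausdorffDist ((fun x => f' x) '' Metric.closedBall (0 : X) 1)
        ((fun y => g' y) '' Metric.closedBall (0 : Y) 1) + ‖g' - g‖ := by
  have h₁ := Metric.hausdorffDist_triangle (u := (fun y => g y) '' Metric.closedBall (0 : Y) 1)
    (hausdorffEDist_image_closedBall_ne_top f f')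
  have h₂ := Metric.hausdorffDist_triangle (u := (fun y => g y) '' Metric.closedBall (0 : Y) 1)
    (hausdorffEDist_image_closedBall_ne_top f' g')
  linarith [hausdorffDist_image_closedBall_le f f', hausdorffDist_image_closedBall_le g' g]

theorem bddBelow_hausdorffDist {E : Type*} [PseudoMetricSpace E] {S : Set ℝ} (h : ∀ r ∈ S, ∃ s t : Set E,
    r = Metric.hausdorffDist s t) : BddBelow S :=
  ⟨0, fun r hr => by
    obtain ⟨s, t, rfl⟩ := h r hr
    exact Metric.hausdorffDist_nonneg⟩

theorem dDelta_anti {δ δ' : ℝ} (h0 : 0 ≤ δ) (h : δ ≤ δ') (X Y : Subspace ℝ E) :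
    dDelta δ' X Y ≤ dDelta δ X Y := by
  refine csInf_le_csInf (bddBelow_hausdorffDist (E := E) ?_) ?_ ?_
  · rintro r ⟨t, s, -, -, rfl⟩
    exact ⟨_, _, rfl⟩
  · exact ⟨_, X.subtypeL, Y.subtypeL, (isEmb_subtypeL X).mono le_rfl h0,
      (isEmb_subtypeL Y).mono le_rfl h0, rfl⟩
  · rintro r ⟨t, s, ht, hs, rfl⟩
    exact ⟨t, s, ht.mono h0 h, hs.mono h0 h, rfl⟩

theorem dDelta_le_DDelta {δ : ℝ} (h0 : 0 ≤ δ) (X Y : Subspace ℝ E) :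
    dDelta δ X Y ≤ DDelta δ X Y := by
  refine csInf_le_csInf (bddBelow_hausdorffDist (E := E) ?_) ?_ ?_
  · rintro r ⟨t, s, -, -, rfl⟩
    exact ⟨_, _, rfl⟩
  · exact ⟨_, _, _, isEpsIsom_of_linearIsometryEquiv h0 (.refl ℝ E),
      isEpsIsom_of_linearIsometryEquiv h0 (.refl ℝ E), rfl⟩
  · rintro r ⟨T, U, hT, hU, rfl⟩
    refine ⟨_, _, hT.isEmb_comp_subtypeL X, hU.isEmb_comp_subtypeL Y, ?_⟩
    rw [image_ballSet, image_ballSet]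
    rfl

theorem DDelta_le_DistDE {δ : ℝ} (h0 : 0 ≤ δ) (X Y : Subspace ℝ E) :
    DDelta δ X Y ≤ DistDE X Y := by
  refine csInf_le_csInf (bddBelow_hausdorffDist (E := E) ?_) ⟨_, .refl ℝ E, rfl⟩ ?_
  · rintro r ⟨T, U, -, -, rfl⟩
    exact ⟨_, _, rfl⟩
  · rintro r ⟨T, rfl⟩
    refine ⟨_, _, isEpsIsom_of_linearIsometryEquiv h0 T,
      isEpsIsom_of_linearIsometryEquiv h0 (.refl ℝ E), ?_⟩
    congr 1
    exact (Set.image_id _).symm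

theorem DistDE_le_of_norm_sub_le {X Y : Subspace ℝ E} {t : X →L[ℝ] E} {s : Y →L[ℝ] E} {ε : ℝ}
    (A B : E ≃ₗᵢ[ℝ] E)
    (hA : ‖A.toLinearIsometry.toContinuousLinearMap.comp t - X.subtypeL‖ ≤ ε)
    (hB : ‖B.toLinearIsometry.toContinuousLinearMap.comp s - Y.subtypeL‖ ≤ ε) :
    DistDE X Y ≤ Metric.hausdorffDist ((fun x => t x) '' Metric.closedBall (0 : X) 1)
      ((fun y => s y) '' Metric.closedBall (0 : Y) 1) + 2 * ε := by
  have hle : DistDE X Y ≤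
      Metric.hausdorffDist ((fun z => (A.symm.trans B) z) '' ballSet X) (ballSet Y) := by
    refine csInf_le (bddBelow_hausdorffDist (E := E) ?_) ⟨_, rfl⟩
    rintro r ⟨T, rfl⟩
    exact ⟨_, _, rfl⟩
  set C : E →L[ℝ] E := (A.symm.trans B).toLinearIsometry.toContinuousLinearMap with hC
  set B' : E →L[ℝ] E := B.toLinearIsometry.toContinuousLinearMap with hB'
  have hCX : ‖C.comp X.subtypeL - B'.comp t‖ ≤ ε := by
    have h0 : 0 ≤ ε := le_trans (by positivity) hA
    refine ContinuousLinearMap.opNorm_le_bound _ h0 fun x => ?_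
    have h : (C.comp X.subtypeL - B'.comp t) x = (A.symm.trans B) (x - A (t x)) := by
      simp [hC, hB']
    rw [h, LinearIsometryEquiv.norm_map, norm_sub_rev]
    exact ContinuousLinearMap.le_of_opNorm_le _ hA x
  have htri := hausdorffDist_image_closedBall_triangle (C.comp X.subtypeL) (B'.comp t)
    Y.subtypeL (B'.comp s)
  have hiso : Metric.hausdorffDist ((fun x => (B'.comp t) x) '' Metric.closedBall (0 : X) 1)
      ((fun y => (B'.comp s) y) '' Metric.closedBall (0 : Y) 1) =
      Metric.hausdorffDist ((fun x => t x) '' Metric.closedBall (0 : X) 1)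
      ((fun y => s y) '' Metric.closedBall (0 : Y) 1) := by
    rw [← Metric.hausdorffDist_image B.isometry (s := (fun x => t x) '' _), Set.image_image,
      Set.image_image]
    rfl
  have hY : ballSet Y = (fun y => Y.subtypeL y) '' Metric.closedBall (0 : Y) 1 := by
    simpa using image_ballSet Y id
  rw [image_ballSet, hY] at hle
  rw [hiso] at htri
  have := hle.trans htri
  linarith

theorem WeakFraisse.exists_DistDE_le_dDelta_add (hE : WeakFraisse E) (X Y : Subspace ℝ E)
    [FiniteDimensional ℝ X] [FiniteDimensional ℝ Y] {ε : ℝ} (hε : 0 < ε) :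
    ∃ δ > (0 : ℝ), DistDE X Y ≤ dDelta δ X Y + ε := by
  obtain ⟨δ₁, h₁, H₁⟩ := hE X ‹_› (ε / 2) (half_pos hε)
  obtain ⟨δ₂, h₂, H₂⟩ := hE Y ‹_› (ε / 2) (half_pos hε)
  have hδ : 0 < min δ₁ δ₂ := lt_min h₁ h₂
  refine ⟨min δ₁ δ₂, hδ, ?_⟩
  rw [← sub_le_iff_le_add]
  refine le_csInf ⟨_, X.subtypeL, Y.subtypeL, (isEmb_subtypeL X).mono le_rfl hδ.le,
      (isEmb_subtypeL Y).mono le_rfl hδ.le, rfl⟩ ?_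
  rintro r ⟨t, s, ht, hs, rfl⟩
  obtain ⟨A, hA⟩ := H₁ t X.subtypeL (ht.mono hδ.le (min_le_left _ _))
    ((isEmb_subtypeL X).mono le_rfl h₁.le)
  obtain ⟨B, hB⟩ := H₂ s Y.subtypeL (hs.mono hδ.le (min_le_right _ _))
    ((isEmb_subtypeL Y).mono le_rfl h₂.le)
  have := DistDE_le_of_norm_sub_le A B hA.le hB.le
  linarith

theorem iSup_Ioi_eq_of_le_of_forall_exists {f : ℝ → ℝ} {a : ℝ} (hle : ∀ δ > 0, f δ ≤ a)
    (hex : ∀ ε > 0, ∃ δ > 0, a ≤ f δ + ε) : ⨆ δ : Set.Ioi (0 : ℝ), f δ = a := by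
  have : Nonempty (Set.Ioi (0 : ℝ)) := ⟨⟨1, one_pos (α := ℝ)⟩⟩
  refine le_antisymm (ciSup_le fun δ => hle δ δ.2) (le_of_forall_pos_le_add fun ε hε => ?_)
  obtain ⟨δ, hδ, h⟩ := hex ε hε
  have hb : BddAbove (Set.range fun δ : Set.Ioi (0 : ℝ) => f δ) :=
    ⟨a, by rintro _ ⟨δ, rfl⟩; exact hle δ δ.2⟩
  exact h.trans (by gcongr; exact le_ciSup hb ⟨δ, hδ⟩)

end Helpers

/-- If `E` is weak Fraïssé, then `γ_E^a`, `γ_E`, `D_E^a` and `D_E` all coincide on pairs of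
finite-dimensional subspaces of `E`. -/
theorem pseudometrics_coincide_of_weakFraisse
    (E : Type*) [NormedAddCommGroup E] [NormedSpace ℝ E] [CompleteSpace E]
    (hE : WeakFraisse E) :
    ∀ X Y : Subspace ℝ E, FiniteDimensional ℝ X → FiniteDimensional ℝ Y →
      gammaA X Y = gammaE X Y ∧ gammaE X Y = DistDA X Y ∧ DistDA X Y = DistDE X Y := by
  intro X Y _ _
  have hex : ∀ ε > 0, ∃ δ > 0, DistDE X Y ≤ dDelta δ X Y + ε := fun ε hε =>
    hE.exists_DistDE_le_dDelta_add X Y hε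
  have hgA : gammaA X Y = DistDE X Y := iSup_Ioi_eq_of_le_of_forall_exists
    (fun δ hδ => (dDelta_le_DDelta hδ.le X Y).trans (DDelta_le_DistDE hδ.le X Y)) hex
  have hDA : DistDA X Y = DistDE X Y := iSup_Ioi_eq_of_le_of_forall_exists
    (fun δ hδ => DDelta_le_DistDE hδ.le X Y) fun ε hε => by
      obtain ⟨δ, hδ, h⟩ := hex ε hε
      exact ⟨δ, hδ, h.trans (by gcongr; exact dDelta_le_DDelta hδ.le X Y)⟩
  have hg : gammaE X Y = DistDE X Y := by
    refine le_antisymm ((dDelta_le_DDelta le_rfl X Y).trans (DDelta_le_DistDE le_rfl X Y))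
      (le_of_forall_pos_le_add fun ε hε => ?_)
    obtain ⟨δ, hδ, h⟩ := hex ε hε
    exact h.trans (by gcongr; exact dDelta_anti le_rfl hδ.le X Y)
  exact ⟨hgA.trans hg.symm, hg.trans hDA.symm, hDA⟩
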